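/- arXiv:2003.10935 — 6 statements merged into one kernel-verified Lean document; each statement's English description precedes it below -/
import Mathlib

section
/- For every finite set V and every finite family A of binary relations on V there exists a coarsest coherent configuration refining A, i.e., a coherent configuration c on V that refines A and such that every coherent configuration on V refining A also refines c. -/
/-- `c : V × V → K` is a coherent configuration with intersection numbers `q`:
(i) a colour is diagonal or off-diagonal consistently, (ii) the converse colour is
well defined, (iii) the number of `(b,d)`-triangles over a pair depends only on its colour. -/
def IsCoherentWith {V K : Type} (c : V × V → K) (q : K × K × K → ℕ) : Prop :=
  (∀ u v u' v' : V, c (u, v) = c (u', v') → (u = v ↔ u' = v')) ∧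
  (∀ u v u' v' : V, c (u, v) = c (u', v') → c (v, u) = c (v', u')) ∧
  (∀ (a b d : K) (u v : V), c (u, v) = a →
    {w : V | c (u, w) = b ∧ c (w, v) = d}.ncard = q (a, b, d))

/-- `c` is a coherent configuration. -/
def IsCoherent {V K : Type} (c : V × V → K) : Prop :=
  ∃ q : K × K × K → ℕ, IsCoherentWith c q

/-- The class of a colour `a`. -/
def colourClass {V K : Type} (c : V × V → K) (a : K) : Set (V × V) := {p | c p = a}

/-- A colour is attained if it lies in the image of `c`. -/
def Attained {V K : Type} (c : V × V → K) (a : K) : Prop := a ∈ Set.range c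

/-- A colour is diagonal if its class is contained in the diagonal. -/
def IsDiagonal {V K : Type} (c : V × V → K) (a : K) : Prop :=
  ∀ p ∈ colourClass c a, p.1 = p.2

/-- `c` refines a family `A` of binary relations: every colour class is contained in
or disjoint from each relation in `A`. -/
def RefinesFamily {V K : Type} (c : V × V → K) (A : Set (Set (V × V))) : Prop :=
  ∀ a : K, ∀ E ∈ A, colourClass c a ⊆ E ∨ Disjoint (colourClass c a) E

/-- `c'` refines `c`: every colour class of `c'` is contained in some colour class of `c`. -/
def RefinesColouring {V K K' : Type} (c' : V × V → K') (c : V × V → K) : Prop :=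
  ∀ p p' : V × V, c' p = c' p' → c p = c p'

/-- `c` is a coarsest coherent configuration refining `A`. -/
def IsCoarsest {V K : Type} (c : V × V → K) (A : Set (Set (V × V))) : Prop :=
  IsCoherent c ∧ RefinesFamily c A ∧
  ∀ (K' : Type) (c' : V × V → K'), IsCoherent c' → RefinesFamily c' A →
    RefinesColouring c' c

/-- `S` is a strongly connected component of the binary relation `R`: an
inclusion-maximal set such that any two of its members are joined by an `R`-path
of length at least `1`. -/
def IsSCC {V : Type} (R : Set (V × V)) (S : Set V) : Prop :=
  (∀ u ∈ S, ∀ v ∈ S, Relation.TransGen (fun x y => (x, y) ∈ R) u v) ∧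
  ∀ T : Set V, S ⊆ T →
    (∀ u ∈ T, ∀ v ∈ T, Relation.TransGen (fun x y => (x, y) ∈ R) u v) → T = S

/-- `E` is a union of colour classes of `c`. -/
def IsUnionOfClasses {V K : Type} (c : V × V → K) (E : Set (V × V)) : Prop :=
  ∀ p p' : V × V, c p = c p' → p ∈ E → p' ∈ E

/-- Composition of binary relations. -/
def relComp {V : Type} (R S : Set (V × V)) : Set (V × V) :=
  {p | ∃ v, (p.1, v) ∈ R ∧ (v, p.2) ∈ S}

/-- The Gaifman graph of the family `A` restricted to `U` is connected. -/
def GaifmanConnected {V : Type} (A : Set (Set (V × V))) (U : Set V) : Prop :=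
  U.Nonempty ∧ ∀ u ∈ U, ∀ v ∈ U,
    Relation.ReflTransGen
      (fun x y => x ∈ U ∧ y ∈ U ∧ ∃ E ∈ A, (x, y) ∈ E ∨ (y, x) ∈ E) u v

/-- Two functions on a finite type with equally large fibres differ by a permutation. -/
theorem exists_perm_of_ncard_fiber_eq {V L : Type} [Finite V] (g g' : V → L)
    (h : ∀ y, {w | g w = y}.ncard = {w | g' w = y}.ncard) :
    ∃ e : V ≃ V, ∀ w, g' (e w) = g w := by
  have hfib (y : L) : Nonempty ({w // g w = y} ≃ {w // g' w = y}) :=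
    ⟨(Finite.equivFinOfCardEq (h y)).trans (Finite.equivFin _).symm⟩
  refine ⟨(Equiv.sigmaFiberEquiv g).symm.trans
    ((Equiv.sigmaCongrRight fun y => (hfib y).some).trans (Equiv.sigmaFiberEquiv g')), ?_⟩
  intro w
  exact ((hfib (g w)).some ⟨w, rfl⟩).2

/-- The number of triangles counted by a coarsening `f` of a coherent configuration `c`
depends only on the colour under `c` of the base pair. -/
theorem IsCoherent.ncard_comp_eq {V K L : Type} [Finite V] {c : V × V → K} (hc : IsCoherent c)
    {f : V × V → L} (hf : RefinesColouring c f) {p p' : V × V} (h : c p = c p') (b d : L) :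
    {w | f (p.1, w) = b ∧ f (w, p.2) = d}.ncard =
      {w | f (p'.1, w) = b ∧ f (w, p'.2) = d}.ncard := by
  obtain ⟨q, -, -, hq⟩ := hc
  obtain ⟨e, he⟩ := exists_perm_of_ncard_fiber_eq
    (fun w => (c (p.1, w), c (w, p.2))) (fun w => (c (p'.1, w), c (w, p'.2))) (by
      rintro ⟨x, y⟩
      simp only [Prod.mk.injEq]
      rw [hq (c p) x y p.1 p.2 rfl, hq (c p) x y p'.1 p'.2 h.symm])
  have he₁ (w : V) : f (p'.1, e w) = f (p.1, w) := hf _ _ (congrArg Prod.fst (he w))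
  have he₂ (w : V) : f (e w, p'.2) = f (w, p.2) := hf _ _ (congrArg Prod.snd (he w))
  rw [← Set.ncard_image_of_injective _ e.injective, Equiv.image_eq_preimage_symm]
  congr 1
  ext w
  simp [← he₁, ← he₂]

/-- Two pairs are related if some coherent configuration refining `A` gives them the same
colour. -/
def SameColourInSome {V : Type} (A : Set (Set (V × V))) (p p' : V × V) : Prop :=
  ∃ (K : Type) (c : V × V → K), IsCoherent c ∧ RefinesFamily c A ∧ c p = c p'

/-- The colouring whose classes are those of the equivalence relation generated by
`SameColourInSome A`. -/
def joinColouring {V : Type} (A : Set (Set (V × V))) : V × V → Quot (SameColourInSome A) :=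
  Quot.mk _

theorem IsCoherent.refinesColouring_joinColouring {V K : Type} {A : Set (Set (V × V))}
    {c : V × V → K} (hc : IsCoherent c) (hA : RefinesFamily c A) :
    RefinesColouring c (joinColouring A) :=
  fun _ _ h => Quot.sound ⟨K, c, hc, hA, h⟩

/-- A function constant along `SameColourInSome A` is constant on the classes of
`joinColouring A`. -/
theorem eq_of_joinColouring_eq {V X : Type} {A : Set (Set (V × V))} (F : V × V → X)
    (hF : ∀ p p', SameColourInSome A p p' → F p = F p') {p p' : V × V}
    (h : joinColouring A p = joinColouring A p') : F p = F p' :=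
  congrArg (Quot.lift F hF) h

theorem isCoherent_joinColouring {V : Type} [Finite V] (A : Set (Set (V × V))) :
    IsCoherent (joinColouring A) := by
  refine ⟨fun t => {w | joinColouring A (t.1.out.1, w) = t.2.1 ∧
    joinColouring A (w, t.1.out.2) = t.2.2}.ncard, ?_, ?_, ?_⟩
  · intro u v u' v' h
    refine iff_of_eq (eq_of_joinColouring_eq (fun p => p.1 = p.2) ?_ h)
    rintro p p' ⟨K, c, ⟨q, hdiag, -⟩, -, hp⟩
    exact propext (hdiag _ _ _ _ hp)
  · intro u v u' v' h
    refine eq_of_joinColouring_eq (fun p => joinColouring A p.swap) ?_ h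
    rintro p p' ⟨K, c, hc, hA, hp⟩
    refine hc.refinesColouring_joinColouring hA _ _ ?_
    obtain ⟨q, -, hswap, -⟩ := hc
    exact hswap _ _ _ _ hp
  · intro a b d u v h
    refine eq_of_joinColouring_eq (p := (u, v)) (p' := a.out)
      (fun p => {w | joinColouring A (p.1, w) = b ∧ joinColouring A (w, p.2) = d}.ncard) ?_
      (h.trans a.out_eq.symm)
    rintro p p' ⟨K, c, hc, hA, hp⟩
    exact hc.ncard_comp_eq (hc.refinesColouring_joinColouring hA) hp b d

theorem refinesFamily_joinColouring {V : Type} (A : Set (Set (V × V))) :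
    RefinesFamily (joinColouring A) A := by
  intro a E hE
  have key {p p' : V × V} (h : joinColouring A p = joinColouring A p') : (p ∈ E) = (p' ∈ E) := by
    refine eq_of_joinColouring_eq (fun p => p ∈ E) ?_ h
    rintro p p' ⟨K, c, -, hA, hp⟩
    rcases hA (c p) E hE with hsub | hdisj
    · exact propext (iff_of_true (hsub rfl) (hsub hp.symm))
    · exact propext (iff_of_false (Set.disjoint_left.1 hdisj rfl)
        (Set.disjoint_left.1 hdisj hp.symm))
  by_cases ha : a.out ∈ E
  · exact .inl fun p hp => (key (hp.trans a.out_eq.symm)).mpr ha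
  · exact .inr (Set.disjoint_left.2 fun p hp hpE =>
      ha ((key (hp.trans a.out_eq.symm)).mp hpE))

/-- For every finite set `V` and every finite family `A` of binary relations on `V`
there exists a coarsest coherent configuration refining `A`. -/
theorem exists_coarsest_coherent_configuration (V : Type) [Fintype V]
    (A : Set (Set (V × V))) (hA : A.Finite) :
    ∃ (K : Type) (c : V × V → K), IsCoarsest c A := by
  exact ⟨_, joinColouring A, isCoherent_joinColouring A, refinesFamily_joinColouring A,
    fun _ _ hc hcA => hc.refinesColouring_joinColouring hcA⟩
end

section
/- Let c be a coherent configuration on a finite set V and let a be an attained colour. Then all strongly connected components of the directed graph (V, class(a)) have the same cardinality, where a strongly connected component of a binary relation R is an inclusion-maximal set S ⊆ V such that for all u, v ∈ S there is a directed R-path of length at least 1 from u to v. -/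
/-- An intermediate vertex over one pair transfers to every pair of the same colour. -/
theorem IsCoherent.exists_triangle {V K : Type} [Finite V] {c : V × V → K} (h : IsCoherent c)
    {x y x' y' : V} (hc : c (x, y) = c (x', y')) (w : V) :
    ∃ w', c (x', w') = c (x, w) ∧ c (w', y') = c (w, y) := by
  obtain ⟨q, -, -, hq⟩ := h
  have hcard : {z : V | c (x, z) = c (x, w) ∧ c (z, y) = c (w, y)}.ncard =
      {z : V | c (x', z) = c (x, w) ∧ c (z, y') = c (w, y)}.ncard :=
    (hq _ _ _ x y rfl).trans (hq _ _ _ x' y' hc.symm).symm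
  have hpos : 0 < {z : V | c (x, z) = c (x, w) ∧ c (z, y) = c (w, y)}.ncard :=
    (Set.ncard_pos (Set.toFinite _)).2 ⟨w, rfl, rfl⟩
  rw [hcard] at hpos
  exact (Set.ncard_pos (Set.toFinite _)).1 hpos

/-- Reachability along a colour class is a union of colour classes. -/
theorem IsCoherent.transGen_of_colour_eq {V K : Type} [Finite V] {c : V × V → K}
    (h : IsCoherent c) {a : K} {x y x' y' : V} (hc : c (x, y) = c (x', y'))
    (hxy : Relation.TransGen (fun u v => (u, v) ∈ colourClass c a) x y) :
    Relation.TransGen (fun u v => (u, v) ∈ colourClass c a) x' y' := by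
  induction hxy generalizing y' with
  | single hxy => exact .single (hc.symm.trans hxy)
  | @tail b y _ hby ih =>
    obtain ⟨w, hxw, hwy⟩ := h.exists_triangle hc b
    exact (ih hxw.symm).tail (hwy.trans hby)

/-- The sources of two arcs of the same colour have the same diagonal colour. -/
theorem IsCoherent.diag_colour_eq {V K : Type} [Finite V] {c : V × V → K} (h : IsCoherent c)
    {x y x' y' : V} (hc : c (x, y) = c (x', y')) : c (x, x) = c (x', x') := by
  obtain ⟨w, hxw, -⟩ := h.exists_triangle hc x
  obtain ⟨q, hdiag, -, -⟩ := h
  obtain rfl : x' = w := (hdiag _ _ _ _ hxw).2 rfl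
  exact hxw.symm

/-- Two vertices of the same diagonal colour have equal valencies in every colour. -/
theorem IsCoherent.ncard_out_eq {V K : Type} {c : V × V → K} (h : IsCoherent c)
    {u v : V} (huv : c (u, u) = c (v, v)) (k : K) :
    {w | c (u, w) = k}.ncard = {w | c (v, w) = k}.ncard := by
  obtain ⟨q, -, hconv, hq⟩ := h
  by_cases hk : ∃ x y, c (x, y) = k
  · obtain ⟨x, y, rfl⟩ := hk
    have key (z : V) : {w | c (z, w) = c (x, y)} =
        {w | c (z, w) = c (x, y) ∧ c (w, z) = c (y, x)} :=
      Set.ext fun w => ⟨fun hw => ⟨hw, hconv _ _ _ _ hw⟩, And.left⟩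
    rw [key u, key v]
    exact (hq _ _ _ u u rfl).trans (hq _ _ _ v v huv.symm).symm
  · push Not at hk
    simp [hk]

/-- Two vertices of the same diagonal colour are related by a permutation preserving
the colours of their outgoing pairs. -/
theorem IsCoherent.exists_perm {V K : Type} [Finite V] {c : V × V → K} (h : IsCoherent c)
    {u v : V} (huv : c (u, u) = c (v, v)) : ∃ e : Equiv.Perm V, ∀ w, c (v, e w) = c (u, w) := by
  have hfib (k : K) : Nonempty ({w // c (u, w) = k} ≃ {w // c (v, w) = k}) :=
    Finite.card_eq.1 (h.ncard_out_eq huv k)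
  exact ⟨Equiv.ofFiberEquiv (f := fun w => c (u, w)) (g := fun w => c (v, w))
    fun k => (hfib k).some,
    Equiv.ofFiberEquiv_map (f := fun w => c (u, w)) (g := fun w => c (v, w)) _⟩

/-- A strongly connected component is the mutual reachability class of each of its members. -/
theorem IsSCC.eq_setOf_transGen {V : Type} {R : Set (V × V)} {S : Set V} (hS : IsSCC R S)
    {u : V} (hu : u ∈ S) :
    S = {w | Relation.TransGen (fun x y => (x, y) ∈ R) u w ∧
      Relation.TransGen (fun x y => (x, y) ∈ R) w u} := by
  symm
  apply hS.2
  · exact fun w hw => ⟨hS.1 u hu w hw, hS.1 w hw u hu⟩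
  · exact fun x hx y hy => hx.2.trans hy.1

/-- All strongly connected components of a single colour class of a coherent
configuration have the same cardinality. -/
theorem scc_same_card {V K : Type} [Fintype V]
    (c : V × V → K) (h : IsCoherent c) (a : K) (ha : Attained c a)
    (S T : Set V) (hS : IsSCC (colourClass c a) S) (hT : IsSCC (colourClass c a) T) :
    S.ncard = T.ncard := by
  rcases S.eq_empty_or_nonempty with rfl | ⟨u, hu⟩
  · rw [hS.2 T (Set.empty_subset T) hT.1]
  rcases T.eq_empty_or_nonempty with rfl | ⟨v, hv⟩
  · rw [hT.2 S (Set.empty_subset S) hS.1]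
  obtain ⟨u', hu', -⟩ := Relation.TransGen.head'_iff.1 (hS.1 u hu u hu)
  obtain ⟨v', hv', -⟩ := Relation.TransGen.head'_iff.1 (hT.1 v hv v hv)
  obtain ⟨e, he⟩ := h.exists_perm (h.diag_colour_eq (hu'.trans hv'.symm))
  have hconv (w : V) : c (e w, v) = c (w, u) := by
    obtain ⟨q, -, hconv, -⟩ := h
    exact hconv _ _ _ _ (he w)
  have hST : S = e ⁻¹' T := by
    rw [hS.eq_setOf_transGen hu, hT.eq_setOf_transGen hv]
    ext w
    exact ⟨fun hw => ⟨h.transGen_of_colour_eq (he w).symm hw.1,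
        h.transGen_of_colour_eq (hconv w).symm hw.2⟩,
      fun hw => ⟨h.transGen_of_colour_eq (he w) hw.1, h.transGen_of_colour_eq (hconv w) hw.2⟩⟩
  rw [hST, ← Set.ncard_image_of_injective _ e.injective, Set.image_preimage_eq _ e.surjective]
end

section
/- Let c be a coherent configuration on a finite set V and let a be an attained non-diagonal colour such that all vertices occurring in the class of a have the same diagonal colour (i.e., the support of class(a) is homogeneous). Then there exist distinct vertices u ≠ v lying in a common strongly connected component of the directed graph (V, class(a)); equivalently, class(a) has a strongly connected component containing at least two vertices. -/
/-- A relation on a finite type that can always be continued inside a nonempty set has a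
directed cycle. -/
theorem exists_transGen_self {V : Type*} [Finite V] (r : V → V → Prop) (P : V → Prop)
    (hP : ∃ x, P x) (hr : ∀ x, P x → ∃ y, P y ∧ r x y) : ∃ u, Relation.TransGen r u u := by
  by_contra! hirr
  let s : V → V → Prop := fun x y => Relation.TransGen r y x
  have : IsTrans V s := ⟨fun _ _ _ hxy hyz => hyz.trans hxy⟩
  have : Std.Irrefl s := ⟨hirr⟩
  obtain ⟨m, hm, hmin⟩ := (Finite.wellFounded_of_trans_of_irrefl s).has_min {x | P x} hP
  obtain ⟨y, hy, hmy⟩ := hr m hm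
  exact hmin y hy (.single hmy)

/-- The vertices lying on a common closed path with `u` form a strongly connected component. -/
theorem isSCC_of_transGen_self {V : Type} (R : Set (V × V)) (u : V)
    (hu : Relation.TransGen (fun x y => (x, y) ∈ R) u u) :
    IsSCC R {w | Relation.TransGen (fun x y => (x, y) ∈ R) u w ∧
      Relation.TransGen (fun x y => (x, y) ∈ R) w u} :=
  ⟨fun _ hx _ hy => hx.2.trans hy.1, fun _ hST hT =>
    Set.Subset.antisymm (fun w hw => ⟨hT u (hST ⟨hu, hu⟩) w hw, hT w hw u (hST ⟨hu, hu⟩)⟩) hST⟩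

/-- In a coherent configuration, whether a vertex has an out-neighbour of a given colour
depends only on its diagonal colour. -/
theorem IsCoherent.exists_outNeighbour {V K : Type} [Finite V] {c : V × V → K}
    (h : IsCoherent c) {x y z : V} (hxy : c (x, x) = c (y, y)) :
    ∃ w, c (y, w) = c (x, z) := by
  obtain ⟨q, -, -, hq⟩ := h
  have hx := hq _ (c (x, z)) (c (z, x)) x x rfl
  have hy := hq _ (c (x, z)) (c (z, x)) y y hxy.symm
  have hpos := (Set.ncard_pos (Set.toFinite _)).2
    (⟨z, rfl, rfl⟩ : {w : V | c (x, w) = c (x, z) ∧ c (w, x) = c (z, x)}.Nonempty)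
  rw [hx, ← hy, Set.ncard_pos (Set.toFinite _)] at hpos
  obtain ⟨w, hw, -⟩ := hpos
  exact ⟨w, hw⟩

/-- A non-diagonal attained colour whose class has homogeneous support has a
strongly connected component with at least two vertices. -/
theorem nondiagonal_homogeneous_has_nontrivial_scc {V K : Type} [Fintype V]
    (c : V × V → K) (h : IsCoherent c) (a : K) (ha : Attained c a)
    (hnd : ¬ IsDiagonal c a)
    (hhom : ∀ x y : V,
      ((∃ z, c (x, z) = a) ∨ (∃ z, c (z, x) = a)) →
      ((∃ z, c (y, z) = a) ∨ (∃ z, c (z, y) = a)) →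
      c (x, x) = c (y, y)) :
    ∃ (u v : V) (S : Set V), u ≠ v ∧ IsSCC (colourClass c a) S ∧ u ∈ S ∧ v ∈ S := by
  have hne : ∀ x y, c (x, y) = a → x ≠ y := by
    rintro x y hxy rfl
    obtain ⟨q, hdiag, -⟩ := h
    exact hnd fun p hp => (hdiag x x p.1 p.2 (hxy.trans (Eq.symm hp))).1 rfl
  obtain ⟨⟨x₀, z₀⟩, hxz⟩ := ha
  obtain ⟨u, hu⟩ := exists_transGen_self (fun x y => (x, y) ∈ colourClass c a)
    (fun x => (∃ z, c (x, z) = a) ∨ (∃ z, c (z, x) = a)) ⟨x₀, .inl ⟨z₀, hxz⟩⟩ (by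
      intro x hx
      obtain ⟨w, hw⟩ := h.exists_outNeighbour (z := z₀) (hhom x₀ x (.inl ⟨z₀, hxz⟩) hx)
      exact ⟨w, .inr ⟨x, hw.trans hxz⟩, hw.trans hxz⟩)
  obtain ⟨v, huv, hvu⟩ := Relation.TransGen.head'_iff.1 hu
  refine ⟨u, v, _, hne u v huv, isSCC_of_transGen_self _ u hu, ⟨hu, hu⟩, .single huv, ?_⟩
  rcases Relation.reflTransGen_iff_eq_or_transGen.1 hvu with rfl | hvu
  · exact hu
  · exact hvu
end

section
/- Let V = V1 ⊎ V2 be a finite set partitioned into two parts and let c be a coherent configuration on V such that every colour class of c is either contained in V1² ∪ V2² (a plain colour) or contained in (V1 × V2) ∪ (V2 × V1) (a crossing colour). Let c' be the colouring obtained from c by identifying any two crossing colours a, a' whose classes have equal domains and equal codomains (i.e., dom(class(a)) = dom(class(a')) and codom(class(a)) = codom(class(a'))). Then c' is a coherent configuration on V. -/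
/-- The set of points whose loop has the same colour as the loop at `u`. -/
def fibre {V K : Type} (c : V × V → K) (u : V) : Set V := {x | c (x, x) = c (u, u)}

theorem fibre_eq_iff {V K : Type} {c : V × V → K} {u u' : V} :
    fibre c u = fibre c u' ↔ c (u, u) = c (u', u') := by
  constructor
  · intro h
    have hu : u ∈ fibre c u := rfl
    rw [h] at hu
    exact hu
  · intro h
    simp only [fibre, h]

/-- In a coherent configuration, pairs of the same colour are matched by a bijection of the
third vertices which preserves the colours of the triangles. -/
theorem IsCoherent.exists_equiv {V K : Type} [Finite V] {c : V × V → K} (h : IsCoherent c)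
    {u v u' v' : V} (huv : c (u, v) = c (u', v')) :
    ∃ e : V ≃ V, ∀ w, c (u', e w) = c (u, w) ∧ c (e w, v') = c (w, v) := by
  obtain ⟨q, -, -, h3⟩ := h
  let f : V → K × K := fun w => (c (u, w), c (w, v))
  let g : V → K × K := fun w => (c (u', w), c (w, v'))
  have hcard : ∀ k, Nonempty ({w // f w = k} ≃ {w // g w = k}) := by
    rintro ⟨b, d⟩
    refine Finite.card_eq.1 ?_
    have h1 := h3 _ b d u v huv
    rw [← h3 _ b d u' v' rfl] at h1
    rw [← Nat.card_coe_set_eq, ← Nat.card_coe_set_eq] at h1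
    simp only [f, g, Prod.mk.injEq]
    exact h1
  refine ⟨Equiv.ofFiberEquiv fun k => (hcard k).some, fun w => ?_⟩
  have hw := Equiv.ofFiberEquiv_map (fun k => (hcard k).some) w
  simpa only [f, g, Prod.mk.injEq] using hw

theorem IsCoherent.loop_left {V K : Type} [Finite V] {c : V × V → K} (h : IsCoherent c)
    {u v u' v' : V} (huv : c (u, v) = c (u', v')) : c (u, u) = c (u', u') := by
  obtain ⟨e, he⟩ := h.exists_equiv huv
  obtain ⟨q, h1, -, -⟩ := h
  have hu := (he u).1
  have heq : u' = e u := (h1 _ _ _ _ hu).2 rfl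
  rw [← heq] at hu
  exact hu.symm

theorem IsCoherent.swap {V K : Type} {c : V × V → K} (h : IsCoherent c)
    {u v u' v' : V} (huv : c (u, v) = c (u', v')) : c (v, u) = c (v', u') := by
  obtain ⟨q, -, h2, -⟩ := h
  exact h2 _ _ _ _ huv

theorem IsCoherent.loop_right {V K : Type} [Finite V] {c : V × V → K} (h : IsCoherent c)
    {u v u' v' : V} (huv : c (u, v) = c (u', v')) : c (v, v) = c (v', v') :=
  h.loop_left (h.swap huv)

theorem IsCoherent.image_fst_colourClass {V K : Type} [Finite V] {c : V × V → K}
    (h : IsCoherent c) (p : V × V) : Prod.fst '' colourClass c (c p) = fibre c p.1 := by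
  ext x
  constructor
  · rintro ⟨⟨y, z⟩, hyz, rfl⟩
    exact h.loop_left hyz
  · intro hx
    obtain ⟨e, he⟩ := h.exists_equiv (Eq.symm hx)
    exact ⟨(x, e p.2), (he p.2).1, rfl⟩

theorem IsCoherent.image_snd_colourClass {V K : Type} [Finite V] {c : V × V → K}
    (h : IsCoherent c) (p : V × V) : Prod.snd '' colourClass c (c p) = fibre c p.2 := by
  ext x
  constructor
  · rintro ⟨⟨y, z⟩, hyz, rfl⟩
    exact h.loop_right hyz
  · intro hx
    obtain ⟨e, he⟩ := h.exists_equiv (Eq.symm hx)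
    exact ⟨(e p.1, x), (he p.1).2, rfl⟩

/-- A colouring is coherent as soon as pairs of the same colour are matched by an injection of
the third vertices which preserves the colours of the triangles. -/
theorem isCoherent_of_injective {V K : Type} [Finite V] {c : V × V → K}
    (h1 : ∀ u v u' v' : V, c (u, v) = c (u', v') → (u = v ↔ u' = v'))
    (h2 : ∀ u v u' v' : V, c (u, v) = c (u', v') → c (v, u) = c (v', u'))
    (h3 : ∀ u v u' v' : V, c (u, v) = c (u', v') → ∃ e : V → V, Function.Injective e ∧
      ∀ w, c (u', e w) = c (u, w) ∧ c (e w, v') = c (w, v)) : IsCoherent c := by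
  have hle : ∀ (b d : K) (u v u' v' : V), c (u, v) = c (u', v') →
      {w : V | c (u, w) = b ∧ c (w, v) = d}.ncard ≤
        {w : V | c (u', w) = b ∧ c (w, v') = d}.ncard := by
    intro b d u v u' v' huv
    obtain ⟨e, hinj, he⟩ := h3 u v u' v' huv
    refine Set.ncard_le_ncard_of_injOn e ?_ hinj.injOn
    rintro w ⟨hb, hd⟩
    exact ⟨(he w).1.trans hb, (he w).2.trans hd⟩
  have hq : ∀ k : K × K × K, ∃ n : ℕ, ∀ u v : V, c (u, v) = k.1 →
      {w : V | c (u, w) = k.2.1 ∧ c (w, v) = k.2.2}.ncard = n := by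
    rintro ⟨a, b, d⟩
    by_cases ha : ∃ u v : V, c (u, v) = a
    · obtain ⟨u', v', ha⟩ := ha
      exact ⟨_, fun u v huv => le_antisymm (hle b d u v u' v' (huv.trans ha.symm))
        (hle b d u' v' u v (ha.trans huv.symm))⟩
    · exact ⟨0, fun u v huv => (ha ⟨u, v, huv⟩).elim⟩
  choose q hq using hq
  exact ⟨q, h1, h2, fun a b d u v huv => hq (a, b, d) u v huv⟩

/-- If every colour class of a coherent configuration `c` on `V = V1 ⊎ V2` is plain
or crossing, then identifying crossing colours whose classes have equal domains and
equal codomains again yields a coherent configuration. -/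
theorem merge_crossing_colours_coherent {V K : Type} [Fintype V]
    (c : V × V → K) (h : IsCoherent c) (V1 : Set V)
    (hsplit : ∀ a : K,
      colourClass c a ⊆ {p : V × V | p.1 ∈ V1 ↔ p.2 ∈ V1} ∨
      colourClass c a ⊆ {p : V × V | ¬(p.1 ∈ V1 ↔ p.2 ∈ V1)})
    (c' : V × V → K ⊕ (Set V × Set V))
    (hc' : ∀ p : V × V,
      ((p.1 ∈ V1 ↔ p.2 ∈ V1) → c' p = Sum.inl (c p)) ∧
      (¬(p.1 ∈ V1 ↔ p.2 ∈ V1) →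
        c' p = Sum.inr
          (Prod.fst '' colourClass c (c p), Prod.snd '' colourClass c (c p)))) :
    IsCoherent c' := by
  classical
  have hplain : ∀ u v : V, (u ∈ V1 ↔ v ∈ V1) → c' (u, v) = Sum.inl (c (u, v)) :=
    fun u v => (hc' (u, v)).1
  have hcross : ∀ u v : V, ¬(u ∈ V1 ↔ v ∈ V1) →
      c' (u, v) = Sum.inr (fibre c u, fibre c v) := by
    intro u v huv
    rw [(hc' (u, v)).2 huv, h.image_fst_colourClass, h.image_snd_colourClass]
  have hpart : ∀ u v u' v' : V, c (u, v) = c (u', v') →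
      ((u ∈ V1 ↔ v ∈ V1) ↔ (u' ∈ V1 ↔ v' ∈ V1)) := by
    intro u v u' v' huv
    rcases hsplit (c (u, v)) with hs | hs
    · exact iff_of_true (@hs (u, v) rfl) (@hs (u', v') huv.symm)
    · exact iff_of_false (@hs (u, v) rfl) (@hs (u', v') huv.symm)
  have hmono : ∀ u v u' v' : V, c (u, v) = c (u', v') → c' (u, v) = c' (u', v') := by
    intro u v u' v' huv
    by_cases hp : (u ∈ V1 ↔ v ∈ V1)
    · rw [hplain u v hp, hplain u' v' ((hpart _ _ _ _ huv).1 hp), huv]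
    · rw [hcross u v hp, hcross u' v' (mt (hpart _ _ _ _ huv).2 hp),
        fibre_eq_iff.2 (h.loop_left huv), fibre_eq_iff.2 (h.loop_right huv)]
  have hcases : ∀ u v u' v' : V, c' (u, v) = c' (u', v') → c (u, v) = c (u', v') ∨
      (¬(u ∈ V1 ↔ v ∈ V1) ∧ ¬(u' ∈ V1 ↔ v' ∈ V1) ∧
        c (u, u) = c (u', u') ∧ c (v, v) = c (v', v')) := by
    intro u v u' v' huv
    by_cases hp : (u ∈ V1 ↔ v ∈ V1) <;> by_cases hp' : (u' ∈ V1 ↔ v' ∈ V1)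
    · rw [hplain u v hp, hplain u' v' hp'] at huv
      exact Or.inl (Sum.inl.inj huv)
    · rw [hplain u v hp, hcross u' v' hp'] at huv
      cases huv
    · rw [hcross u v hp, hplain u' v' hp'] at huv
      cases huv
    · rw [hcross u v hp, hcross u' v' hp'] at huv
      have hf := Prod.mk.inj (Sum.inr.inj huv)
      exact Or.inr ⟨hp, hp', fibre_eq_iff.1 hf.1, fibre_eq_iff.1 hf.2⟩
  refine isCoherent_of_injective ?_ ?_ ?_
  · intro u v u' v' huv
    rcases hcases _ _ _ _ huv with hc | ⟨hp, hp', -, -⟩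
    · obtain ⟨q, h1, -, -⟩ := h
      exact h1 _ _ _ _ hc
    · refine iff_of_false ?_ ?_
      · rintro rfl
        exact hp Iff.rfl
      · rintro rfl
        exact hp' Iff.rfl
  · intro u v u' v' huv
    rcases hcases _ _ _ _ huv with hc | ⟨hp, hp', hu, hv⟩
    · exact hmono _ _ _ _ (h.swap hc)
    · rw [hcross v u (mt Iff.symm hp), hcross v' u' (mt Iff.symm hp'),
        fibre_eq_iff.2 hu, fibre_eq_iff.2 hv]
  · intro u v u' v' huv
    rcases hcases _ _ _ _ huv with hc | ⟨hp, hp', hu, hv⟩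
    · obtain ⟨e, he⟩ := h.exists_equiv hc
      exact ⟨e, e.injective, fun w => ⟨hmono _ _ _ _ (he w).1, hmono _ _ _ _ (he w).2⟩⟩
    -- Third vertices on the side of `u` are matched over `(u, u)`, the others over `(v, v)`.
    · obtain ⟨e₁, he₁⟩ := h.exists_equiv hu
      obtain ⟨e₂, he₂⟩ := h.exists_equiv hv
      have hs₁ : ∀ w, ((u' ∈ V1 ↔ e₁ w ∈ V1) ↔ (u ∈ V1 ↔ w ∈ V1)) :=
        fun w => hpart _ _ _ _ (he₁ w).1
      have hs₂ : ∀ w, ((v' ∈ V1 ↔ e₂ w ∈ V1) ↔ (v ∈ V1 ↔ w ∈ V1)) :=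
        fun w => hpart _ _ _ _ (he₂ w).1
      refine ⟨fun w => if (u ∈ V1 ↔ w ∈ V1) then e₁ w else e₂ w, ?_, ?_⟩
      · intro x y hxy
        have hx₁ := hs₁ x
        have hy₁ := hs₁ y
        have hx₂ := hs₂ x
        have hy₂ := hs₂ y
        dsimp only at hxy
        split_ifs at hxy with hx hy hy
        · exact e₁.injective hxy
        · rw [hxy] at hx₁
          grind
        · rw [← hxy] at hy₁
          grind
        · exact e₂.injective hxy
      · intro w
        have hw₁ := hs₁ w
        have hw₂ := hs₂ w
        dsimp only
        split_ifs with hw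
        · refine ⟨hmono _ _ _ _ (he₁ w).1, ?_⟩
          rw [hcross (e₁ w) v' (by grind), hcross w v (by grind),
            fibre_eq_iff.2 (h.loop_right (he₁ w).1), fibre_eq_iff.2 hv]
        · refine ⟨?_, hmono _ _ _ _ (he₂ w).2⟩
          rw [hcross u' (e₂ w) (by grind), hcross u w hw,
            fibre_eq_iff.2 (h.loop_right (he₂ w).1), fibre_eq_iff.2 hu]
end

section
/- Let V = V1 ⊎ V2 be a finite set partitioned into two parts, let A be a family of binary relations on V with every relation contained in V1² ∪ V2², and assume the Gaifman graph of A restricted to V1 and the Gaifman graph of A restricted to V2 are both connected. Let c be a coarsest coherent configuration refining A. Then the restriction of c to V1 × V1 is a coarsest coherent configuration on V1 refining the family {R ∩ (V1 × V1) : R ∈ A}. -/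
open Relation

/-- Coherence on a finite set in terms of permutations: condition (iii) says that for any two
pairs of the same colour, the third points can be matched so that both colours are kept. -/
theorem isCoherent_iff_exists_perm {V K : Type} [Finite V] (c : V × V → K) :
    IsCoherent c ↔
      (∀ u v u' v' : V, c (u, v) = c (u', v') → (u = v ↔ u' = v')) ∧
      (∀ u v u' v' : V, c (u, v) = c (u', v') → c (v, u) = c (v', u')) ∧
      (∀ u v u' v' : V, c (u, v) = c (u', v') →
        ∃ σ : Equiv.Perm V, ∀ w, c (u', σ w) = c (u, w) ∧ c (σ w, v') = c (w, v)) := by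
  classical
  constructor
  · rintro ⟨q, hdiag, hconv, hq⟩
    refine ⟨hdiag, hconv, fun u v u' v' h => ?_⟩
    have e : ∀ k : K × K, Nonempty
        ({w // (c (u, w), c (w, v)) = k} ≃ {w // (c (u', w), c (w, v')) = k}) := by
      rintro ⟨b, d⟩
      have key := (hq _ b d u v rfl).trans (hq _ b d u' v' h.symm).symm
      refine Finite.card_eq.1 ?_
      simpa only [Prod.mk.injEq, ← Nat.card_coe_set_eq, Set.coe_ofPred] using key
    refine ⟨Equiv.ofFiberEquiv fun k => (e k).some, fun w => ?_⟩
    simpa only [Prod.mk.injEq] using Equiv.ofFiberEquiv_map (fun k => (e k).some) w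
  · rintro ⟨hdiag, hconv, hperm⟩
    refine ⟨fun k => if h : ∃ p : V × V, c p = k.1 then
      {w : V | c (h.choose.1, w) = k.2.1 ∧ c (w, h.choose.2) = k.2.2}.ncard else 0,
      hdiag, hconv, ?_⟩
    rintro a b d u v rfl
    have h : ∃ p : V × V, c p = c (u, v) := ⟨_, rfl⟩
    beta_reduce
    rw [dif_pos h]
    obtain ⟨σ, hσ⟩ := hperm u v h.choose.1 h.choose.2 h.choose_spec.symm
    rw [← Set.ncard_image_of_injective _ σ.injective]
    congr 1
    ext w
    obtain ⟨w, rfl⟩ := σ.surjective w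
    simp [hσ]

/-- Colours of a coherent configuration determine the colours of the loops at the end points. -/
theorem IsCoherent.loop_eq {V K : Type} [Finite V] {c : V × V → K} (hc : IsCoherent c)
    {u v u' v' : V} (h : c (u, v) = c (u', v')) :
    c (u, u) = c (u', u') ∧ c (v, v) = c (v', v') := by
  obtain ⟨hdiag, -, hperm⟩ := (isCoherent_iff_exists_perm c).1 hc
  obtain ⟨σ, hσ⟩ := hperm u v u' v' h
  have hu := (hσ u).1
  have hv := (hσ v).2
  have hu' := (hdiag _ _ _ _ hu).2 rfl
  have hv' := (hdiag _ _ _ _ hv).2 rfl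
  exact ⟨by rw [← hu, ← hu'], by rw [← hv, hv']⟩

/-- A coherent configuration transports along a bijection. -/
theorem IsCoherent.comp_equiv {V W K : Type} [Finite V] [Finite W] {c : W × W → K}
    (hc : IsCoherent c) (e : V ≃ W) : IsCoherent fun p : V × V => c (e p.1, e p.2) := by
  rw [isCoherent_iff_exists_perm] at hc ⊢
  obtain ⟨hdiag, hconv, hperm⟩ := hc
  refine ⟨fun u v u' v' h => by simpa using hdiag _ _ _ _ h,
    fun u v u' v' h => hconv _ _ _ _ h, fun u v u' v' h => ?_⟩
  obtain ⟨σ, hσ⟩ := hperm _ _ _ _ h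
  exact ⟨(e.trans σ).trans e.symm, fun w => by simpa using hσ (e w)⟩

/-- The discrete configuration, in which all pairs have distinct colours, is coherent. -/
theorem isCoherent_id (V : Type) [Finite V] : IsCoherent (id : V × V → V × V) := by
  rw [isCoherent_iff_exists_perm]
  simp only [id, Prod.mk.injEq]
  refine ⟨?_, ?_, ?_⟩
  · rintro u v u' v' ⟨rfl, rfl⟩
    rfl
  · rintro u v u' v' ⟨rfl, rfl⟩
    exact ⟨rfl, rfl⟩
  · rintro u v u' v' ⟨rfl, rfl⟩
    exact ⟨Equiv.refl V, by simp⟩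

/-- The direct sum of two colourings: a cross pair is coloured by the colours of the loops at
its end points. -/
def directSum {V W K L : Type} (c : V × V → K) (d : W × W → L) :
    (V ⊕ W) × (V ⊕ W) → (K ⊕ L) ⊕ (K × L ⊕ L × K)
  | (.inl u, .inl v) => .inl (.inl (c (u, v)))
  | (.inr u, .inr v) => .inl (.inr (d (u, v)))
  | (.inl u, .inr v) => .inr (.inl (c (u, u), d (v, v)))
  | (.inr u, .inl v) => .inr (.inr (d (u, u), c (v, v)))

/-- The direct sum of two coherent configurations is coherent. -/
theorem IsCoherent.directSum {V W K L : Type} [Finite V] [Finite W] {c : V × V → K}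
    {d : W × W → L} (hc : IsCoherent c) (hd : IsCoherent d) : IsCoherent (directSum c d) := by
  obtain ⟨hcdiag, hcconv, hcperm⟩ := (isCoherent_iff_exists_perm c).1 hc
  obtain ⟨hddiag, hdconv, hdperm⟩ := (isCoherent_iff_exists_perm d).1 hd
  rw [isCoherent_iff_exists_perm]
  refine ⟨?_, ?_, ?_⟩
  · rintro (u | u) (v | v) (u' | u') (v' | v') h <;> simp [_root_.directSum] at h ⊢
    · exact hcdiag _ _ _ _ h
    · exact hddiag _ _ _ _ h
  · rintro (u | u) (v | v) (u' | u') (v' | v') h <;> simp [_root_.directSum] at h ⊢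
    · exact hcconv _ _ _ _ h
    · exact h.symm
    · exact h.symm
    · exact hdconv _ _ _ _ h
  · rintro (u | u) (v | v) (u' | u') (v' | v') h <;> simp [_root_.directSum] at h
    · obtain ⟨σ, hσ⟩ := hcperm _ _ _ _ h
      refine ⟨Equiv.sumCongr σ (Equiv.refl W), ?_⟩
      rintro (w | w)
      · simp [_root_.directSum, hσ]
      · simp [_root_.directSum, hc.loop_eq h]
    · obtain ⟨σ, hσ⟩ := hcperm _ _ _ _ h.1
      obtain ⟨τ, hτ⟩ := hdperm _ _ _ _ h.2
      refine ⟨Equiv.sumCongr σ τ, ?_⟩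
      rintro (w | w)
      · simp [_root_.directSum, hσ, h, hc.loop_eq (hσ w).1]
      · simp [_root_.directSum, hτ, h, hd.loop_eq (hτ w).1]
    · obtain ⟨σ, hσ⟩ := hcperm _ _ _ _ h.2
      obtain ⟨τ, hτ⟩ := hdperm _ _ _ _ h.1
      refine ⟨Equiv.sumCongr σ τ, ?_⟩
      rintro (w | w)
      · simp [_root_.directSum, hσ, h, hc.loop_eq (hσ w).1]
      · simp [_root_.directSum, hτ, h, hd.loop_eq (hτ w).1]
    · obtain ⟨τ, hτ⟩ := hdperm _ _ _ _ h
      refine ⟨Equiv.sumCongr (Equiv.refl V) τ, ?_⟩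
      rintro (w | w)
      · simp [_root_.directSum, hd.loop_eq h]
      · simp [_root_.directSum, hτ]

/-- A relation of a refined family is a union of colour classes. -/
theorem refinesFamily_iff {V K : Type} {c : V × V → K} {A : Set (Set (V × V))} :
    RefinesFamily c A ↔ ∀ E ∈ A, IsUnionOfClasses c E := by
  constructor
  · intro h E hE p p' hpp' hp
    rcases h (c p) E hE with h | h
    · exact h hpp'.symm
    · exact absurd hp (Set.disjoint_left.1 h rfl)
  · intro h a E hE
    by_cases hex : ∃ p ∈ E, c p = a
    · obtain ⟨p, hp, rfl⟩ := hex
      exact Or.inl fun p' hp' => h E hE p p' hp'.symm hp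
    · exact Or.inr (Set.disjoint_left.2 fun p hp hpE => hex ⟨p, hpE, hp⟩)

/-- The reflexive transitive closure of a union of colour classes of a coherent configuration is
a union of colour classes. -/
theorem IsCoherent.isUnionOfClasses_reflTransGen {V K : Type} [Finite V] {c : V × V → K}
    (hc : IsCoherent c) {r : V → V → Prop} (hr : IsUnionOfClasses c {p | r p.1 p.2}) :
    IsUnionOfClasses c {p | ReflTransGen r p.1 p.2} := by
  obtain ⟨hdiag, -, hperm⟩ := (isCoherent_iff_exists_perm c).1 hc
  rintro ⟨u, v⟩ ⟨u', v'⟩ h (huv : ReflTransGen r u v)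
  change ReflTransGen r u' v'
  induction huv generalizing v' with
  | refl => rw [(hdiag _ _ _ _ h).1 rfl]
  | @tail b v _ hbv ih =>
    obtain ⟨σ, hσ⟩ := hperm _ _ _ _ h
    exact (ih _ (hσ b).1.symm).tail (hr (b, v) (σ b, v') (hσ b).2.symm hbv)

/-- If the two parts are the connected components of the Gaifman graph of a refined family, then
lying in the same part is a union of colour classes. -/
theorem IsCoherent.isUnionOfClasses_samePart {V K : Type} [Finite V] {c : V × V → K}
    (hc : IsCoherent c) {V1 : Set V} {A : Set (Set (V × V))} (hcA : RefinesFamily c A)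
    (hA : ∀ E ∈ A, E ⊆ {p : V × V | p.1 ∈ V1 ↔ p.2 ∈ V1})
    (h1 : GaifmanConnected A V1) (h2 : GaifmanConnected A V1ᶜ) :
    IsUnionOfClasses c {p | p.1 ∈ V1 ↔ p.2 ∈ V1} := by
  have hconv := ((isCoherent_iff_exists_perm c).1 hc).2.1
  rw [refinesFamily_iff] at hcA
  let r : V → V → Prop := fun x y => ∃ E ∈ A, (x, y) ∈ E ∨ (y, x) ∈ E
  have hr : IsUnionOfClasses c {p | r p.1 p.2} := by
    rintro ⟨u, v⟩ ⟨u', v'⟩ h ⟨E, hE, huv | hvu⟩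
    · exact ⟨E, hE, Or.inl (hcA E hE _ _ h huv)⟩
    · exact ⟨E, hE, Or.inr (hcA E hE _ _ (hconv _ _ _ _ h) hvu)⟩
  have hiff : ∀ u v, ReflTransGen r u v ↔ (u ∈ V1 ↔ v ∈ V1) := by
    refine fun u v => ⟨fun h => ?_, fun h => ?_⟩
    · induction h with
      | refl => rfl
      | tail _ hbv ih =>
        obtain ⟨E, hE, h | h⟩ := hbv
        · exact ih.trans (hA E hE h)
        · exact ih.trans (hA E hE h).symm
    · by_cases hu : u ∈ V1
      · exact ReflTransGen.mono (fun _ _ h => h.2.2) _ _ (h1.2 u hu v (h.1 hu))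
      · exact ReflTransGen.mono (fun _ _ h => h.2.2) _ _ (h2.2 u hu v (mt h.2 hu))
  simpa only [hiff] using hc.isUnionOfClasses_reflTransGen hr

/-- A coherent configuration restricts to a part of a partition into two parts for which lying in
the same part is a union of colour classes. -/
theorem IsCoherent.restrict {V K : Type} [Finite V] {c : V × V → K} (hc : IsCoherent c)
    {V1 : Set V} (hV1 : IsUnionOfClasses c {p | p.1 ∈ V1 ↔ p.2 ∈ V1}) :
    IsCoherent fun p : V1 × V1 => c ((p.1 : V), (p.2 : V)) := by
  rw [isCoherent_iff_exists_perm] at hc ⊢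
  obtain ⟨hdiag, hconv, hperm⟩ := hc
  refine ⟨fun u v u' v' h => by simpa only [Subtype.ext_iff] using hdiag _ _ _ _ h,
    fun u v u' v' h => hconv _ _ _ _ h, fun u v u' v' h => ?_⟩
  obtain ⟨σ, hσ⟩ := hperm _ _ _ _ h
  have hmem : ∀ w, σ w ∈ V1 ↔ w ∈ V1 := fun w => by
    have hto := hV1 _ _ (hσ w).1
    have hfrom := hV1 _ _ (hσ w).1.symm
    simp only [Set.mem_ofPred_eq, u.2, u'.2, true_iff] at hto hfrom
    exact ⟨hto, hfrom⟩
  exact ⟨σ.subtypePerm hmem, fun w => hσ w⟩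

/-- In the normalised setting, the restriction to `V1` of a coarsest coherent
configuration refining `A` is a coarsest coherent configuration on `V1` refining
the restricted family. -/
theorem coarsest_restricts_to_coarsest {V K : Type} [Fintype V]
    (V1 : Set V) (A : Set (Set (V × V)))
    (hA : ∀ E ∈ A, E ⊆ {p : V × V | p.1 ∈ V1 ↔ p.2 ∈ V1})
    (h1 : GaifmanConnected A V1) (h2 : GaifmanConnected A V1ᶜ)
    (c : V × V → K) (hc : IsCoarsest c A) :
    IsCoarsest (fun p : ↥V1 × ↥V1 => c ((p.1 : V), (p.2 : V)))
      ((fun E : Set (V × V) =>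
        {p : ↥V1 × ↥V1 | ((p.1 : V), (p.2 : V)) ∈ E}) '' A) := by
  classical
  obtain ⟨hcoh, href, hmin⟩ := hc
  refine ⟨hcoh.restrict (hcoh.isUnionOfClasses_samePart href hA h1 h2), ?_, ?_⟩
  · rw [refinesFamily_iff] at href ⊢
    rintro _ ⟨E, hE, rfl⟩ p p' h hp
    exact href E hE _ _ h hp
  · intro K' c' hc' hc'A
    rw [refinesFamily_iff] at hc'A
    let e : V1 ⊕ (V1ᶜ : Set V) ≃ V := Equiv.Set.sumCompl V1
    have hmin' := hmin _ _ ((hc'.directSum (isCoherent_id (V1ᶜ : Set V))).comp_equiv e.symm) <| by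
      rw [refinesFamily_iff]
      rintro E hE ⟨u, v⟩ ⟨u', v'⟩ h huv
      have hsame := hA E hE huv
      obtain ⟨u, rfl⟩ := e.surjective u
      obtain ⟨v, rfl⟩ := e.surjective v
      obtain ⟨u', rfl⟩ := e.surjective u'
      obtain ⟨v', rfl⟩ := e.surjective v'
      simp only [Equiv.symm_apply_apply] at h
      rcases u with u | u <;> rcases v with v | v <;> rcases u' with u' | u' <;>
        rcases v' with v' | v' <;> simp [directSum] at h
      · exact hc'A _ ⟨E, hE, rfl⟩ (u, v) (u', v') h huv
      · exact absurd (hsame.1 u.2) v.2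
      · exact absurd (hsame.2 v.2) u.2
      · rwa [← h.1, ← h.2]
    rintro ⟨u, v⟩ ⟨u', v'⟩ h
    refine hmin' (u, v) (u', v') ?_
    simp [e, directSum, h]
end

section
/- Let A be a family of binary relations on a finite set V, let c be a coarsest coherent configuration refining A, let a be an attained colour of c, let 𝒮 be the set of strongly connected components of class(a), and let U := V ∖ ⋃𝒮. Let A_a be the contracted structure with universe U ⊎ 𝒮 whose relations are, for each E ∈ A, the relation (E ∩ U²) ∪ {(u,S) : u ∈ U, S ∈ 𝒮, ∃v ∈ S with (u,v) ∈ E} ∪ {(S,v) : S ∈ 𝒮, v ∈ U, ∃u ∈ S with (u,v) ∈ E} ∪ {(S1,S2) : S1, S2 ∈ 𝒮, ∃u ∈ S1, v ∈ S2 with (u,v) ∈ E}, together with the additional diagonal relation {(S,S) : S ∈ 𝒮}. Let c' be a coarsest coherent configuration refining A_a. Then the restriction of c to U refines the restriction of c' to U: for all u, v, u', v' ∈ U, if c(u,v) = c(u',v') then c'(u,v) = c'(u',v'). -/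
theorem isCoherent_of_ncard_eq {V K : Type} {c : V × V → K}
    (diag : ∀ u v u' v' : V, c (u, v) = c (u', v') → (u = v ↔ u' = v'))
    (symm : ∀ u v u' v' : V, c (u, v) = c (u', v') → c (v, u) = c (v', u'))
    (count : ∀ u v u' v' : V, c (u, v) = c (u', v') → ∀ b d : K,
      {w : V | c (u, w) = b ∧ c (w, v) = d}.ncard =
        {w : V | c (u', w) = b ∧ c (w, v') = d}.ncard) :
    IsCoherent c := by
  classical
  refine ⟨fun t => if h : ∃ p : V × V, c p = t.1 then
    {w : V | c (h.choose.1, w) = t.2.1 ∧ c (w, h.choose.2) = t.2.2}.ncard else 0,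
    diag, symm, ?_⟩
  intro a b d u v huv
  have h : ∃ p : V × V, c p = a := ⟨(u, v), huv⟩
  simp only [dif_pos h]
  exact count _ _ _ _ (huv.trans h.choose_spec.symm) b d

namespace IsCoherent

variable {V K : Type} {c : V × V → K}

theorem eq_iff_eq (hc : IsCoherent c) {u v u' v' : V} (h : c (u, v) = c (u', v')) :
    u = v ↔ u' = v' :=
  hc.choose_spec.1 _ _ _ _ h

theorem swap_s16 (hc : IsCoherent c) {u v u' v' : V} (h : c (u, v) = c (u', v')) :
    c (v, u) = c (v', u') :=
  hc.choose_spec.2.1 _ _ _ _ h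

/-- Pairs of the same colour are matched by a permutation preserving all triangles over them. -/
theorem exists_perm_s16 [Finite V] (hc : IsCoherent c) {u v u' v' : V}
    (h : c (u, v) = c (u', v')) :
    ∃ σ : Equiv.Perm V, ∀ w, c (u', σ w) = c (u, w) ∧ c (σ w, v') = c (w, v) := by
  obtain ⟨q, -, -, hq⟩ := hc
  have key : ∀ k : K × K, Nonempty
      ({w // (c (u, w), c (w, v)) = k} ≃ {w // (c (u', w), c (w, v')) = k}) := by
    rintro ⟨b, d⟩
    have hcard := (hq _ b d u v h).trans (hq _ b d u' v' rfl).symm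
    simp only [Prod.mk.injEq]
    exact Finite.card_eq.mp hcard
  refine ⟨Equiv.ofFiberEquiv fun k => (key k).some, fun w => ?_⟩
  exact Prod.mk.inj (Equiv.ofFiberEquiv_map (fun k => (key k).some) w)

theorem left_eq [Finite V] (hc : IsCoherent c) {u v u' v' : V} (h : c (u, v) = c (u', v')) :
    c (u, u) = c (u', u') := by
  obtain ⟨σ, hσ⟩ := hc.exists_perm_s16 h
  have h' := (hσ u).1
  have : u' = σ u := (hc.eq_iff_eq h').mpr rfl
  rw [← h', ← this]

theorem right_eq [Finite V] (hc : IsCoherent c) {u v u' v' : V} (h : c (u, v) = c (u', v')) :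
    c (v, v) = c (v', v') :=
  hc.left_eq (hc.swap_s16 h)

/-- Reachability along a colour class is a union of colour classes. -/
theorem transGen_colourClass [Finite V] (hc : IsCoherent c) {a : K} {u v u' v' : V}
    (h : c (u, v) = c (u', v'))
    (huv : Relation.TransGen (fun x y => (x, y) ∈ colourClass c a) u v) :
    Relation.TransGen (fun x y => (x, y) ∈ colourClass c a) u' v' := by
  induction huv generalizing v' with
  | single huv => exact .single (h.symm.trans huv)
  | @tail w v _ hwv ih =>
    obtain ⟨σ, hσ⟩ := hc.exists_perm_s16 h
    exact .tail (ih (hσ w).1.symm) ((hσ w).2.trans hwv)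

end IsCoherent

/-- The colouring induced on the target of `π`: the set of colours between two fibres. -/
def quotientColouring {W X K : Type} (e : W × W → K) (π : W → X) (z : X × X) : Set K :=
  {k | ∃ p q, π p = z.1 ∧ π q = z.2 ∧ e (p, q) = k}

section Quotient

variable {W X K : Type} {e : W × W → K} {π : W → X}

theorem exists_eq_of_quotientColouring_eq {p q : W} {z : X × X}
    (h : quotientColouring e π (π p, π q) = quotientColouring e π z) :
    ∃ p' q', π p' = z.1 ∧ π q' = z.2 ∧ e (p', q') = e (p, q) := by
  have : e (p, q) ∈ quotientColouring e π (π p, π q) := ⟨p, q, rfl, rfl, rfl⟩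
  rwa [h] at this

variable [Finite W]

theorem quotientColouring_eq_of_eq (he : IsCoherent e)
    (hker : ∀ p q p' q', e (p, q) = e (p', q') → π p = π q → π p' = π q')
    {p q p' q' : W} (h : e (p, q) = e (p', q')) :
    quotientColouring e π (π p, π q) = quotientColouring e π (π p', π q') := by
  have key : ∀ p q p' q' : W, e (p, q) = e (p', q') →
      quotientColouring e π (π p, π q) ⊆ quotientColouring e π (π p', π q') := by
    rintro p q p' q' h k ⟨r, s, hr, hs, rfl⟩
    obtain ⟨σ, hσ⟩ := he.exists_perm_s16 h
    obtain ⟨τ, hτ⟩ := he.exists_perm_s16 (hσ r).2.symm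
    exact ⟨σ r, τ s, (hker _ _ _ _ (hσ r).1.symm hr.symm).symm,
      hker _ _ _ _ (hτ s).2.symm hs, (hτ s).1⟩
  exact (key _ _ _ _ h).antisymm (key _ _ _ _ h.symm)

theorem ncard_fibre_eq (he : IsCoherent e)
    (hker : ∀ p q p' q', e (p, q) = e (p', q') → π p = π q → π p' = π q')
    {w w' : W} (h : e (w, w) = e (w', w')) :
    (π ⁻¹' {π w}).ncard = (π ⁻¹' {π w'}).ncard := by
  obtain ⟨σ, hσ⟩ := he.exists_perm_s16 h
  rw [← Set.ncard_image_of_injective _ σ.injective]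
  congr 1
  ext r
  obtain ⟨s, rfl⟩ := σ.surjective r
  simp only [Set.mem_image, EmbeddingLike.apply_eq_iff_eq, exists_eq_right, Set.mem_preimage,
    Set.mem_singleton_iff]
  exact ⟨hker _ _ _ _ (hσ s).2.symm, hker _ _ _ _ (hσ s).2⟩

theorem ncard_preimage_eq_mul (hπ : Function.Surjective π) (Z : Set X) (s : ℕ)
    (hs : ∀ z ∈ Z, (π ⁻¹' {z}).ncard = s) : (π ⁻¹' Z).ncard = Z.ncard * s := by
  classical
  have := Fintype.ofFinite W
  have := Fintype.ofSurjective π hπ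
  rw [Set.ncard_eq_toFinset_card', Set.ncard_eq_toFinset_card',
    Finset.card_eq_sum_card_fiberwise (f := π) (t := Z.toFinset) (by intro x; simp),
    Finset.sum_const_nat]
  intro z hz
  rw [← hs z (by simpa using hz), Set.ncard_eq_toFinset_card']
  congr 1
  ext w
  simp only [Finset.mem_filter, Set.mem_toFinset, Set.mem_preimage, Set.mem_singleton_iff,
    and_iff_right_iff_imp]
  rintro rfl
  simpa using hz

theorem isCoherent_quotientColouring (he : IsCoherent e) (hπ : Function.Surjective π)
    (hker : ∀ p q p' q', e (p, q) = e (p', q') → π p = π q → π p' = π q') :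
    IsCoherent (quotientColouring e π) := by
  apply isCoherent_of_ncard_eq
  · intro x y x' y' h
    obtain ⟨p, rfl⟩ := hπ x
    obtain ⟨q, rfl⟩ := hπ y
    obtain ⟨p', q', rfl, rfl, h'⟩ := exists_eq_of_quotientColouring_eq h
    exact ⟨hker _ _ _ _ h'.symm, hker _ _ _ _ h'⟩
  · intro x y x' y' h
    obtain ⟨p, rfl⟩ := hπ x
    obtain ⟨q, rfl⟩ := hπ y
    obtain ⟨p', q', rfl, rfl, h'⟩ := exists_eq_of_quotientColouring_eq h
    exact quotientColouring_eq_of_eq he hker (he.swap_s16 h'.symm)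
  · intro x y x' y' h B D
    obtain ⟨p, rfl⟩ := hπ x
    obtain ⟨q, rfl⟩ := hπ y
    obtain ⟨p', q', rfl, rfl, h'⟩ := exists_eq_of_quotientColouring_eq h
    obtain ⟨σ, hσ⟩ := he.exists_perm_s16 h'.symm
    set Z := {z | quotientColouring e π (π p, z) = B ∧ quotientColouring e π (z, π q) = D}
      with hZ
    set Z' := {z | quotientColouring e π (π p', z) = B ∧ quotientColouring e π (z, π q') = D}
      with hZ'
    have hmem : ∀ w, π (σ w) ∈ Z' ↔ π w ∈ Z := by
      intro w
      simp only [hZ, hZ', Set.mem_ofPred_eq, quotientColouring_eq_of_eq he hker (hσ w).1,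
        quotientColouring_eq_of_eq he hker (hσ w).2]
    have hcard : (π ⁻¹' Z).ncard = (π ⁻¹' Z').ncard := by
      rw [← Set.ncard_image_of_injective _ σ.injective]
      congr 1
      ext r
      obtain ⟨s, rfl⟩ := σ.surjective r
      simp [hmem]
    rcases Z.eq_empty_or_nonempty with hempty | ⟨z, hz⟩
    · have : Z' = ∅ := by
        rw [Set.eq_empty_iff_forall_notMem]
        intro z' hz'
        obtain ⟨r, rfl⟩ := hπ z'
        obtain ⟨s, rfl⟩ := σ.surjective r
        rw [hmem, hempty] at hz'
        exact hz'
      rw [hempty, this]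
    · obtain ⟨w, rfl⟩ := hπ z
      have hfib : ∀ r t, quotientColouring e π (π r, t) = B →
          (π ⁻¹' {t}).ncard = (π ⁻¹' {π w}).ncard := by
        intro r t ht
        obtain ⟨r', s', -, rfl, hrs⟩ := exists_eq_of_quotientColouring_eq (hz.1.trans ht.symm)
        exact ncard_fibre_eq he hker (he.right_eq hrs)
      rw [ncard_preimage_eq_mul hπ Z _ fun t ht => hfib _ t ht.1,
        ncard_preimage_eq_mul hπ Z' _ fun t ht => hfib _ t ht.1] at hcard
      refine Nat.eq_of_mul_eq_mul_right ?_ hcard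
      rw [Set.ncard_pos]
      exact ⟨w, rfl⟩

/-- A coherent configuration upstairs whose quotient respects `F` refines the pullback of a
coarsest coherent configuration refining `F`. -/
theorem IsCoarsest.eq_of_quotient {K' : Type} {F : Set (Set (X × X))} {c' : X × X → K'}
    (hc' : IsCoarsest c' F) (he : IsCoherent e) (hπ : Function.Surjective π)
    (hker : ∀ p q p' q', e (p, q) = e (p', q') → π p = π q → π p' = π q')
    (hF : ∀ E ∈ F, ∀ p q p' q', e (p, q) = e (p', q') → (π p, π q) ∈ E → (π p', π q') ∈ E)
    {p q p' q' : W} (h : e (p, q) = e (p', q')) :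
    c' (π p, π q) = c' (π p', π q') := by
  refine hc'.2.2 _ _ (isCoherent_quotientColouring he hπ hker) ?_ _ _
    (quotientColouring_eq_of_eq he hker h)
  intro k E hE
  rw [or_iff_not_imp_right, Set.not_disjoint_iff]
  rintro ⟨⟨x, y⟩, hk, hxy⟩ ⟨x', y'⟩ hk'
  obtain ⟨p, rfl⟩ := hπ x
  obtain ⟨q, rfl⟩ := hπ y
  obtain ⟨p', q', rfl, rfl, h'⟩ :=
    exists_eq_of_quotientColouring_eq (Eq.trans hk (Eq.symm hk'))
  exact hF E hE _ _ _ _ h'.symm hxy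

end Quotient

/-- The extension of a colouring by an isolated point. -/
def optionColouring {V K : Type} (c : V × V → K) :
    Option V × Option V → Option K × Option K × Option K
  | (x, y) => (x.map fun u => c (u, u), Option.map₂ (fun u v => c (u, v)) x y,
      y.map fun v => c (v, v))

theorem isCoherent_optionColouring {V K : Type} [Finite V] {c : V × V → K}
    (hc : IsCoherent c) : IsCoherent (optionColouring c) := by
  have hperm : ∀ x y x' y' : Option V,
      optionColouring c (x, y) = optionColouring c (x', y') →
      ∃ σ : Equiv.Perm (Option V), ∀ w,
        optionColouring c (x', σ w) = optionColouring c (x, w) ∧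
        optionColouring c (σ w, y') = optionColouring c (w, y) := by
    intro x y x' y' h
    have lift : ∀ u v u' v', c (u, v) = c (u', v') → ∃ σ : Equiv.Perm V, ∀ w,
        c (u', σ w) = c (u, w) ∧ c (σ w, v') = c (w, v) ∧ c (σ w, σ w) = c (w, w) ∧
        c (u', u') = c (u, u) ∧ c (v', v') = c (v, v) := by
      intro u v u' v' h
      obtain ⟨σ, hσ⟩ := hc.exists_perm_s16 h
      exact ⟨σ, fun w => ⟨(hσ w).1, (hσ w).2, hc.right_eq (hσ w).1, hc.left_eq h.symm,
        hc.right_eq h.symm⟩⟩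
    rcases x with _ | u <;> rcases y with _ | v <;> rcases x' with _ | u' <;>
      rcases y' with _ | v' <;> simp [optionColouring] at h
    · exact ⟨1, fun w => ⟨rfl, rfl⟩⟩
    · obtain ⟨σ, hσ⟩ := lift _ _ _ _ h
      refine ⟨σ.optionCongr, ?_⟩
      rintro (_ | w)
      · simp [optionColouring, h]
      · simp [optionColouring, hσ w]
    · obtain ⟨σ, hσ⟩ := lift _ _ _ _ h
      refine ⟨σ.optionCongr, ?_⟩
      rintro (_ | w)
      · simp [optionColouring, h]
      · simp [optionColouring, hσ w]
    · obtain ⟨σ, hσ⟩ := lift _ _ _ _ h.2.1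
      refine ⟨σ.optionCongr, ?_⟩
      rintro (_ | w)
      · simp [optionColouring, h]
      · simp [optionColouring, hσ w]
  apply isCoherent_of_ncard_eq
  · intro x y x' y' h
    rcases x with _ | u <;> rcases y with _ | v <;> rcases x' with _ | u' <;>
      rcases y' with _ | v' <;> simp [optionColouring] at h ⊢
    exact hc.eq_iff_eq h.2.1
  · intro x y x' y' h
    rcases x with _ | u <;> rcases y with _ | v <;> rcases x' with _ | u' <;>
      rcases y' with _ | v' <;> simp [optionColouring] at h ⊢
    · exact h
    · exact h
    · exact ⟨h.2.2, hc.swap_s16 h.2.1, h.1⟩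
  · intro x y x' y' h b d
    obtain ⟨σ, hσ⟩ := hperm _ _ _ _ h
    rw [← Set.ncard_image_of_injective _ σ.injective]
    congr 1
    ext r
    obtain ⟨s, rfl⟩ := σ.surjective r
    simp [hσ]

section SCC

variable {V : Type} {R : Set (V × V)}

theorem IsSCC.eq_of_mem {T : Set V} (hT : IsSCC R T) {v : V} (hv : v ∈ T) :
    T = {w | Relation.TransGen (fun x y => (x, y) ∈ R) v w ∧
      Relation.TransGen (fun x y => (x, y) ∈ R) w v} := by
  symm
  apply hT.2
  · exact fun w hw => ⟨hT.1 v hv w hw, hT.1 w hw v hv⟩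
  · exact fun u hu w hw => hu.2.trans hw.1

theorem exists_isSCC_mem {v : V} (hv : Relation.TransGen (fun x y => (x, y) ∈ R) v v) :
    ∃ T, IsSCC R T ∧ v ∈ T := by
  refine ⟨{w | Relation.TransGen (fun x y => (x, y) ∈ R) v w ∧
    Relation.TransGen (fun x y => (x, y) ∈ R) w v},
    ⟨fun u hu w hw => hu.2.trans hw.1, fun T hT h => ?_⟩, hv, hv⟩
  refine Set.Subset.antisymm (fun w hw => ?_) hT
  exact ⟨h v (hT ⟨hv, hv⟩) w hw, h w hw v (hT ⟨hv, hv⟩)⟩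

theorem IsSCC.nonempty {T : Set V} (hT : IsSCC R T) {v : V}
    (hv : Relation.TransGen (fun x y => (x, y) ∈ R) v v) : T.Nonempty := by
  rw [Set.nonempty_iff_ne_empty]
  rintro rfl
  have : ({v} : Set V) = ∅ := hT.2 {v} (Set.empty_subset _) (by rintro _ rfl _ rfl; exact hv)
  simp at this

end SCC

/-- Contracting the strongly connected components of a colour class of a coarsest
coherent configuration does not refine the colouring on the remaining vertices:
the restriction of `c` to `U` refines the restriction of a coarsest coherent
configuration `c'` of the contracted structure to `U`. -/
theorem contraction_does_not_refine {V K K' : Type} [Fintype V]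
    (A : Set (Set (V × V))) (c : V × V → K) (hc : IsCoarsest c A)
    (a : K) (ha : Attained c a)
    (𝒮 : Set (Set V)) (h𝒮 : 𝒮 = {T : Set V | IsSCC (colourClass c a) T})
    (U : Set V) (hU : U = {v : V | ∀ T ∈ 𝒮, v ∉ T})
    (contract : Set (V × V) → Set ((↥U ⊕ ↥𝒮) × (↥U ⊕ ↥𝒮)))
    (hcon1 : ∀ (E : Set (V × V)) (u v : ↥U),
      ((Sum.inl u, Sum.inl v) ∈ contract E ↔ ((u : V), (v : V)) ∈ E))
    (hcon2 : ∀ (E : Set (V × V)) (u : ↥U) (T : ↥𝒮),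
      ((Sum.inl u, Sum.inr T) ∈ contract E ↔ ∃ w ∈ (T : Set V), ((u : V), w) ∈ E))
    (hcon3 : ∀ (E : Set (V × V)) (T : ↥𝒮) (v : ↥U),
      ((Sum.inr T, Sum.inl v) ∈ contract E ↔ ∃ w ∈ (T : Set V), (w, (v : V)) ∈ E))
    (hcon4 : ∀ (E : Set (V × V)) (T₁ T₂ : ↥𝒮),
      ((Sum.inr T₁, Sum.inr T₂) ∈ contract E ↔
        ∃ w₁ ∈ (T₁ : Set V), ∃ w₂ ∈ (T₂ : Set V), (w₁, w₂) ∈ E))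
    (c' : (↥U ⊕ ↥𝒮) × (↥U ⊕ ↥𝒮) → K')
    (hc' : IsCoarsest c'
      (insert {q : (↥U ⊕ ↥𝒮) × (↥U ⊕ ↥𝒮) | ∃ T : ↥𝒮, q = (Sum.inr T, Sum.inr T)}
        (contract '' A))) :
    ∀ u v u' v' : ↥U, c ((u : V), (v : V)) = c ((u' : V), (v' : V)) →
      c' (Sum.inl u, Sum.inl v) = c' (Sum.inl u', Sum.inl v') := by
  classical
  obtain ⟨hcoh, hrefA, -⟩ := hc
  have hA : ∀ E ∈ A, ∀ p p', c p = c p' → p ∈ E → p' ∈ E := by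
    intro E hE p p' hpp' hp
    rcases hrefA (c p) E hE with h | h
    · exact h hpp'.symm
    · exact absurd hp (Set.disjoint_left.mp h rfl)
  let reach : V → V → Prop := Relation.TransGen (fun x y => (x, y) ∈ colourClass c a)
  have hmemU : ∀ v, v ∈ U ↔ ¬ reach v v := by
    intro v
    rw [hU]
    constructor
    · intro h hv
      obtain ⟨T, hT, hvT⟩ := exists_isSCC_mem hv
      exact h T (h𝒮 ▸ hT) hvT
    · intro h T hT hvT
      rw [h𝒮] at hT
      exact h (hT.1 v hvT v hvT)
  have hscc : ∀ T ∈ 𝒮, IsSCC (colourClass c a) T := fun T hT => by rwa [h𝒮] at hT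
  by_cases hcyc : ∃ v, reach v v
  · obtain ⟨v₀, hv₀⟩ := hcyc
    let block : ↥U ⊕ ↥𝒮 → Set V := Sum.elim (fun u => {(u : V)}) (fun T => (T : Set V))
    have hcon : ∀ E x y, (x, y) ∈ contract E ↔ ∃ p ∈ block x, ∃ q ∈ block y, (p, q) ∈ E := by
      rintro E (x | x) (y | y) <;> simp [block, hcon1, hcon2, hcon3, hcon4]
    have hcover : ∀ v, ∃ x, v ∈ block x := by
      intro v
      by_cases hv : v ∈ U
      · exact ⟨Sum.inl ⟨v, hv⟩, rfl⟩
      · obtain ⟨T, hT, hvT⟩ := exists_isSCC_mem (not_not.mp fun h => hv ((hmemU v).mpr h))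
        exact ⟨Sum.inr ⟨T, h𝒮 ▸ hT⟩, hvT⟩
    have hnotU : ∀ v (T : ↥𝒮), v ∈ (T : Set V) → v ∉ U := by
      intro v T hv hvU
      exact (hmemU v).mp hvU ((hscc T T.2).1 v hv v hv)
    have huniq : ∀ v x y, v ∈ block x → v ∈ block y → x = y := by
      rintro v (x | x) (y | y) hx hy
      · exact congrArg Sum.inl (Subtype.ext (Eq.trans (Eq.symm hx) hy))
      · exact absurd ((show v = x from hx) ▸ x.2) (hnotU v y hy)
      · exact absurd ((show v = y from hy) ▸ y.2) (hnotU v x hx)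
      · exact congrArg Sum.inr (Subtype.ext
          (((hscc x x.2).eq_of_mem hx).trans ((hscc y y.2).eq_of_mem hy).symm))
    choose π hπmem using hcover
    have hπ : ∀ {v x}, v ∈ block x → π v = x := fun {v x} h => huniq v _ _ (hπmem v) h
    have hπU : ∀ u : ↥U, π u = Sum.inl u := fun u => hπ rfl
    have hsurj : Function.Surjective π := by
      rintro (u | T)
      · exact ⟨u, hπU u⟩
      · obtain ⟨v, hv⟩ := (hscc T T.2).nonempty hv₀
        exact ⟨v, hπ hv⟩
    have hrel : ∀ p q, π p = π q ↔ p = q ∨ reach p q ∧ reach q p := by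
      intro p q
      constructor
      · intro h
        have hp := hπmem p
        have hq := hπmem q
        rw [← h] at hq
        rcases hx : π p with u | T
        · rw [hx] at hp hq
          exact Or.inl (Eq.trans hp (Eq.symm hq))
        · rw [hx] at hp hq
          exact Or.inr ⟨(hscc T T.2).1 p hp q hq, (hscc T T.2).1 q hq p hp⟩
      · rintro (rfl | ⟨hpq, hqp⟩)
        · rfl
        · obtain ⟨T, hT, hpT⟩ := exists_isSCC_mem (hpq.trans hqp)
          have hqT : q ∈ T := by rw [hT.eq_of_mem hpT]; exact ⟨hpq, hqp⟩
          exact (hπ (x := Sum.inr ⟨T, h𝒮 ▸ hT⟩) hpT).trans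
            (hπ (x := Sum.inr ⟨T, h𝒮 ▸ hT⟩) hqT).symm
    have hker : ∀ p q p' q', c (p, q) = c (p', q') → π p = π q → π p' = π q' := by
      intro p q p' q' h
      rw [hrel, hrel]
      rintro (hpq | ⟨hpq, hqp⟩)
      · exact Or.inl ((hcoh.eq_iff_eq h).mp hpq)
      · exact Or.inr ⟨hcoh.transGen_colourClass h hpq,
          hcoh.transGen_colourClass (hcoh.swap_s16 h) hqp⟩
    intro u v u' v' h
    rw [← hπU, ← hπU, ← hπU, ← hπU]
    refine hc'.eq_of_quotient hcoh hsurj hker ?_ h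
    rintro E (rfl | ⟨E, hE, rfl⟩) p q p' q' hpq hmem
    · obtain ⟨T, hT⟩ := hmem
      obtain ⟨hp, hq⟩ := Prod.mk.inj hT
      have hpT := hπmem p
      rw [hp] at hpT
      have hp' : reach p' p' :=
        hcoh.transGen_colourClass (hcoh.left_eq hpq) ((hscc T T.2).1 p hpT p hpT)
      have heq := hker _ _ _ _ hpq (hp.trans hq.symm)
      rcases hx : π p' with x | T'
      · have hp'x := hπmem p'
        rw [hx] at hp'x
        exact absurd hp' ((hmemU p').mp ((show p' = x from hp'x) ▸ x.2))
      · exact ⟨T', by rw [← heq, hx]⟩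
    · rw [hcon] at hmem ⊢
      obtain ⟨r, hr, s, hs, hrs⟩ := hmem
      have hquot := quotientColouring_eq_of_eq hcoh hker hpq
      rw [← hπ hr, ← hπ hs] at hquot
      obtain ⟨r', s', hr', hs', hrs'⟩ := exists_eq_of_quotientColouring_eq hquot
      rw [← show π r' = π p' from hr', ← show π s' = π q' from hs']
      exact ⟨r', hπmem r', s', hπmem s', hA E hE _ _ hrs'.symm hrs⟩
  · have hUall : ∀ v, v ∈ U := fun v => (hmemU v).mpr fun h => hcyc ⟨v, h⟩
    have hempty : ∀ T ∈ 𝒮, T = ∅ := by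
      intro T hT
      rw [Set.eq_empty_iff_forall_notMem]
      exact fun v hv => hcyc ⟨v, (hscc T hT).1 v hv v hv⟩
    have hmem𝒮 : ∅ ∈ 𝒮 := by
      rw [h𝒮]
      refine ⟨by simp, fun T _ hT => ?_⟩
      rw [Set.eq_empty_iff_forall_notMem]
      exact fun v hv => hcyc ⟨v, hT v hv v hv⟩
    let π : Option V → ↥U ⊕ ↥𝒮 := fun x =>
      x.elim (Sum.inr ⟨∅, hmem𝒮⟩) fun v => Sum.inl ⟨v, hUall v⟩
    have hinj : Function.Injective π := by
      rintro (_ | x) (_ | y) h <;> simp [π] at h ⊢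
      exact h
    have hsurj : Function.Surjective π := by
      rintro (u | ⟨T, hT⟩)
      · exact ⟨some u, rfl⟩
      · obtain rfl := hempty T hT
        exact ⟨none, rfl⟩
    intro u v u' v' h
    refine hc'.eq_of_quotient (π := π) (isCoherent_optionColouring hcoh) hsurj ?_ ?_
      (p := some u) (q := some v) (p' := some u') (q' := some v') ?_
    · intro p q p' q' hpq
      rw [hinj.eq_iff, hinj.eq_iff]
      exact ((isCoherent_optionColouring hcoh).eq_iff_eq hpq).mp
    · rintro E (rfl | ⟨E, hE, rfl⟩) p q p' q' hpq hmem <;> rcases p with _ | p <;>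
        rcases q with _ | q <;> rcases p' with _ | p' <;> rcases q' with _ | q' <;>
        simp [optionColouring, π, hcon1, hcon2, hcon3, hcon4] at hpq hmem ⊢
      · exact hmem
      · exact hA E hE _ _ hpq.2.1 hmem
    · simp [optionColouring, h, hcoh.left_eq h, hcoh.right_eq h]
end
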